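/- Let K = 4m for a positive integer m, and let H : Fin K × Fin K → ℂ be channel coefficients satisfying the Wyner linear-network topology H(i,j) = 0 if and only if i ∉ {j, j+1}, with all coefficients H(j,j) and H(j+1,j) nonzero. Let A = {i ∈ {1,…,K} : i mod 4 ∈ {1, 2, 0}} be the set of active users and let T be the transmit sets T(4j+1) = {4j+1, 4j+2}, T(4j+2) = {4j+2}, T(4j+4) = {4j+3}, T(4j+3) = ∅. Then there exist beamforming coefficients v : Fin K × Fin K → ℂ with v(i,t) = 0 whenever t ∉ T(i), such that for every active receiver i ∈ A: (a) the desired-signal coefficient ∑_t H(i,t) · v(i,t) is nonzero, and (b) for every other message k ≠ i, the interference coefficient ∑_t H(i,t) · v(k,t) equals zero. In particular, each active receiver observes its desired message free of interference. -/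

import Mathlib

theorem sum_mul_single {ι R : Type*} [Fintype ι] [DecidableEq ι] [NonAssocSemiring R]
    (f : ι → R) (a : ι) (c : R) : ∑ t, f t * (Pi.single a c : ι → R) t = f a * c := by
  simp [Pi.single_apply]

/-- Cooperative zero-forcing in the Wyner linear network.  Let `K = 4m` and let
`H (i, j)` be the channel coefficient from transmitter `j` to receiver `i`, with the
linear-network topology: `H (i, j) = 0` iff `i ∉ {j, j + 1}` (in 0-based indices;
the last transmitter is only connected to its own receiver).  Users `1, …, K` are
indexed by `Fin K` (user `i+1` is index `i`); the active users `A` are those with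
1-based index `≡ 1, 2, 0 (mod 4)`, i.e. 0-based index `i.val % 4 ≠ 2`, and the
transmit sets are the optimal ones (0-based): `T (4j) = {4j, 4j+1}`,
`T (4j+1) = {4j+1}`, `T (4j+2) = ∅`, `T (4j+3) = {4j+2}`.  Then there exist
beamforming coefficients `v (i, t)`, vanishing whenever `t ∉ T i`, such that every
active receiver gets a nonzero desired-signal coefficient and zero interference
coefficient from every other message. -/
theorem cooperative_zero_forcing
    (m : ℕ) (hm : 0 < m) (K : ℕ) (hK : K = 4 * m)
    (H : Fin K × Fin K → ℂ)
    (hH : ∀ i j : Fin K, H (i, j) = 0 ↔ ¬(i.val = j.val ∨ i.val = j.val + 1))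
    (T : Fin K → Finset (Fin K))
    (hT1 : ∀ j, (hj : j < m) →
      T ⟨4 * j, by omega⟩ = {⟨4 * j, by omega⟩, ⟨4 * j + 1, by omega⟩})
    (hT2 : ∀ j, (hj : j < m) → T ⟨4 * j + 1, by omega⟩ = {⟨4 * j + 1, by omega⟩})
    (hT3 : ∀ j, (hj : j < m) → T ⟨4 * j + 2, by omega⟩ = ∅)
    (hT4 : ∀ j, (hj : j < m) → T ⟨4 * j + 3, by omega⟩ = {⟨4 * j + 2, by omega⟩}) :
    ∃ v : Fin K × Fin K → ℂ,
      (∀ i t : Fin K, t ∉ T i → v (i, t) = 0) ∧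
      (∀ i : Fin K, i.val % 4 ≠ 2 →
        (∑ t : Fin K, H (i, t) * v (i, t)) ≠ 0 ∧
        (∀ k : Fin K, k ≠ i → (∑ t : Fin K, H (i, t) * v (k, t)) = 0)) := by
  have beam : ∀ k : Fin K, ∃ w : Fin K → ℂ, (∀ t, t ∉ T k → w t = 0) ∧
      ∀ i : Fin K, i.val % 4 ≠ 2 → (∑ t, H (i, t) * w t = 0 ↔ k ≠ i) := by
    rintro ⟨k, hk⟩
    obtain ⟨j, hj, rfl | rfl | rfl | rfl⟩ : ∃ j, j < m ∧
        (k = 4 * j ∨ k = 4 * j + 1 ∨ k = 4 * j + 2 ∨ k = 4 * j + 3) :=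
      ⟨k / 4, by omega, by omega⟩
    · set a : Fin K := ⟨4 * j, by omega⟩ with ha
      set b : Fin K := ⟨4 * j + 1, by omega⟩ with hb
      have hbb : H (b, b) ≠ 0 := by simp [hH]
      refine ⟨Pi.single a 1 + Pi.single b (-H (b, a) / H (b, b)), fun t ht => ?_,
        fun i hi => ?_⟩
      · rw [hT1 j hj] at ht
        simp only [Finset.mem_insert, Finset.mem_singleton, not_or] at ht
        rw [Pi.add_apply, Pi.single_eq_of_ne ht.1, Pi.single_eq_of_ne ht.2, add_zero]
      · simp only [Pi.add_apply, mul_add, Finset.sum_add_distrib, sum_mul_single, mul_one]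
        by_cases hib : i = b
        · have hne : a ≠ b := by simp [ha, hb]
          rw [hib, mul_div_cancel₀ _ hbb, add_neg_cancel]
          exact iff_of_true rfl hne
        · have hib' : i.val ≠ 4 * j + 1 := fun h => hib (Fin.ext h)
          have h0 : H (i, b) = 0 := (hH _ _).2 (by simp only [hb]; omega)
          rw [h0, zero_mul, add_zero, hH, ne_eq, Fin.ext_iff]
          simp only [ha]
          omega
    · refine ⟨Pi.single ⟨4 * j + 1, hk⟩ 1, fun t ht => ?_, fun i hi => ?_⟩
      · rw [hT2 j hj, Finset.mem_singleton] at ht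
        exact Pi.single_eq_of_ne ht _
      · rw [sum_mul_single, mul_one, hH, ne_eq, Fin.ext_iff]
        dsimp only
        omega
    · refine ⟨0, fun _ _ => rfl, fun i hi => ?_⟩
      simp only [Pi.zero_apply, mul_zero, Finset.sum_const_zero, true_iff, ne_eq, Fin.ext_iff]
      omega
    · refine ⟨Pi.single ⟨4 * j + 2, by omega⟩ 1, fun t ht => ?_, fun i hi => ?_⟩
      · rw [hT4 j hj, Finset.mem_singleton] at ht
        exact Pi.single_eq_of_ne ht _
      · rw [sum_mul_single, mul_one, hH, ne_eq, Fin.ext_iff]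
        dsimp only
        omega
  choose w hsupp hzf using beam
  exact ⟨fun p => w p.1 p.2, hsupp, fun i hi =>
    ⟨fun h => (hzf i i hi).1 h rfl, fun k hk => (hzf k i hi).2 hk⟩⟩
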